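/- arXiv:1708.05911 — 2 statements merged into one kernel-verified Lean document; each statement's English description precedes it below -/
import Mathlib

section
/- Let X be a compact topological space, let E be a nontrivial finite-dimensional real normed space, let g : X → (E →L[ℝ] E →L[ℝ] ℝ) be a continuous family of continuous bilinear forms on E, and let g₀ : X → (E →L[ℝ] E →L[ℝ] ℝ) be a continuous family such that g₀(x) is positive definite for every x ∈ X. Then for every ε > 0 there exists λ > 0 such that, setting g̃(x) := (1/λ) • g(x) + g₀(x), one has for every x ∈ X: (i) g̃(x) is positive definite, (ii) g(x) = λ • (g̃(x) − g₀(x)), and (iii) ‖g̃(x) − g₀(x)‖ < ε in the operator norm on E →L[ℝ] E →L[ℝ] ℝ. -/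
/-- A continuous bilinear form is positive definite if `B v v > 0` for all `v ≠ 0`. -/
def PosDefCLM {E : Type*} [NormedAddCommGroup E] [NormedSpace ℝ E]
    (B : E →L[ℝ] E →L[ℝ] ℝ) : Prop :=
  ∀ v : E, v ≠ 0 → 0 < B v v

/-- A continuous family of positive-definite forms over a compact base is uniformly coercive. -/
theorem exists_uniform_coercivity_of_posDefCLM {X : Type*} [TopologicalSpace X] [CompactSpace X]
    {E : Type*} [NormedAddCommGroup E] [NormedSpace ℝ E] [FiniteDimensional ℝ E]
    {B : X → (E →L[ℝ] E →L[ℝ] ℝ)} (hB : Continuous B) (hpos : ∀ x, PosDefCLM (B x)) :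
    ∃ c : ℝ, 0 < c ∧ ∀ x v, c * ‖v‖ ^ 2 ≤ B x v v := by
  have : ProperSpace E := FiniteDimensional.proper_real E
  have hcont : Continuous fun p : X × E => B p.1 p.2 p.2 := by fun_prop
  obtain ⟨c, hc, hle⟩ := (isCompact_univ.prod (isCompact_sphere (0 : E) 1)).exists_forall_le'
    hcont.continuousOn (a := 0) fun p hp =>
      hpos p.1 p.2 (ne_zero_of_mem_unit_sphere ⟨p.2, hp.2⟩)
  refine ⟨c, hc, fun x v => ?_⟩
  rcases eq_or_ne v 0 with rfl | hv
  · simp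
  have hn : 0 < ‖v‖ := norm_pos_iff.mpr hv
  have h := hle (x, ‖v‖⁻¹ • v) ⟨Set.mem_univ x, by simp [norm_smul, hn.ne']⟩
  simp only [map_smul, smul_apply, smul_eq_mul] at h
  calc c * ‖v‖ ^ 2 ≤ ‖v‖⁻¹ * (‖v‖⁻¹ * B x v v) * ‖v‖ ^ 2 := by gcongr
    _ = B x v v := by field_simp

/-- A perturbation of a coercive form by a form of smaller norm is positive definite. -/
theorem PosDefCLM.add_of_norm_lt {E : Type*} [NormedAddCommGroup E] [NormedSpace ℝ E]
    {A B : E →L[ℝ] E →L[ℝ] ℝ} {c : ℝ} (hB : ∀ v, c * ‖v‖ ^ 2 ≤ B v v) (hA : ‖A‖ < c) :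
    PosDefCLM (A + B) := by
  intro v hv
  have hn : 0 < ‖v‖ := norm_pos_iff.mpr hv
  have hAv : -(‖A‖ * ‖v‖ * ‖v‖) ≤ A v v := (abs_le.mp (A.le_opNorm₂ v v)).1
  have hlt : ‖A‖ * ‖v‖ ^ 2 < c * ‖v‖ ^ 2 := by gcongr
  rw [add_apply, add_apply]
  linarith [hB v]

/-- Trivialized-bundle form of Lemma 1: over a compact base, any continuous family of
bilinear forms `g` can be written as `λ` times the difference of a positive-definite family
arbitrarily close to the positive-definite reference family `g₀`, and `g₀` itself. -/
theorem lemma_perturbation_family {X : Type*} [TopologicalSpace X] [CompactSpace X]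
    {E : Type*} [NormedAddCommGroup E] [NormedSpace ℝ E] [FiniteDimensional ℝ E]
    [Nontrivial E]
    (g g₀ : X → (E →L[ℝ] E →L[ℝ] ℝ))
    (hg : Continuous g) (hg₀ : Continuous g₀)
    (hpos : ∀ x : X, PosDefCLM (g₀ x))
    {ε : ℝ} (hε : 0 < ε) :
    ∃ lam : ℝ, 0 < lam ∧ ∀ x : X,
      PosDefCLM ((1 / lam) • g x + g₀ x) ∧
      g x = lam • (((1 / lam) • g x + g₀ x) - g₀ x) ∧
      ‖((1 / lam) • g x + g₀ x) - g₀ x‖ < ε := by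
  obtain ⟨c, hc, hcoer⟩ := exists_uniform_coercivity_of_posDefCLM hg₀ hpos
  obtain ⟨C, hC⟩ := isCompact_univ.exists_bound_of_continuousOn (f := g) hg.continuousOn
  have hm : 0 < min c ε := lt_min hc hε
  have hD : 0 < |C| + 1 := by positivity
  have hlam : 0 < (|C| + 1) / min c ε := div_pos hD hm
  refine ⟨(|C| + 1) / min c ε, hlam, fun x => ?_⟩
  have hsmall : ‖(1 / ((|C| + 1) / min c ε)) • g x‖ < min c ε := by
    have hgx : ‖g x‖ < |C| + 1 := by linarith [hC x (Set.mem_univ x), le_abs_self C]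
    set_option maxSynthPendingDepth 3 in
    rw [norm_smul, Real.norm_of_nonneg (by positivity), one_div_div, div_mul_eq_mul_div,
      div_lt_iff₀ hD]
    gcongr
  refine ⟨PosDefCLM.add_of_norm_lt (hcoer x) (hsmall.trans_le (min_le_left _ _)), ?_, ?_⟩
  · set_option maxSynthPendingDepth 3 in
    rw [add_sub_cancel_right, smul_smul, mul_one_div_cancel hlam.ne', one_smul]
  · set_option maxSynthPendingDepth 3 in
    rw [add_sub_cancel_right]
    exact hsmall.trans_le (min_le_right _ _)
end

section
/- Let E be a real normed vector space, let g : ℝ → E be a C^∞ function, let a < b be real numbers, and let P > b − a. Then there exists a C^∞ function G : ℝ → E that is periodic with period P (G(t + P) = G(t) for all t) and satisfies G(t) = g(t) for all t ∈ [a, b]. -/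
/-- A smooth function vanishing outside a ball around `c` of radius less than `P / 2` agrees on
the ball of radius `P / 2` around `c` with a smooth `P`-periodic function. -/
theorem exists_contDiff_periodic_of_eq_zero {E : Type*} [NormedAddCommGroup E] [NormedSpace ℝ E]
    {n : WithTop ℕ∞} {h : ℝ → E} (hh : ContDiff ℝ n h) {c r P : ℝ} (hP : 0 < P) (hr : r < P / 2)
    (h_zero : ∀ t, r ≤ |t - c| → h t = 0) :
    ∃ G : ℝ → E, ContDiff ℝ n G ∧ (∀ t, G (t + P) = G t) ∧
      ∀ t, |t - c| < P / 2 → G t = h t := by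
  have key : ∀ (t : ℝ) (k : ℤ), |t - k * P - c| < P - r →
      h (t - round ((t - c) / P) * P) = h (t - k * P) := by
    intro t k htk
    obtain hm | hm := eq_or_ne (round ((t - c) / P)) k
    · rw [hm]
    have hround := abs_sub_round ((t - c) / P)
    generalize round ((t - c) / P) = m at hm hround ⊢
    have hmP : |t - m * P - c| ≤ P / 2 := by
      have : t - m * P - c = ((t - c) / P - m) * P := by field_simp; ring
      rw [this, abs_mul, abs_of_pos hP]
      nlinarith
    have hsep : P ≤ |t - k * P - c| + |t - m * P - c| := by
      have h1 : (1 : ℝ) ≤ |(m : ℝ) - k| := by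
        exact_mod_cast Int.one_le_abs (sub_ne_zero.2 hm)
      have h2 : (t - k * P - c) - (t - m * P - c) = ((m : ℝ) - k) * P := by ring
      have h3 := abs_sub (t - k * P - c) (t - m * P - c)
      rw [h2, abs_mul, abs_of_pos hP] at h3
      nlinarith
    rw [h_zero _ (by linarith), h_zero _ (by linarith)]
  refine ⟨fun t => h (t - round ((t - c) / P) * P), ?_, fun t => ?_, fun t ht => ?_⟩
  · rw [contDiff_iff_contDiffAt]
    intro t₀
    have hk : |t₀ - round ((t₀ - c) / P) * P - c| < P - r := by
      have : t₀ - round ((t₀ - c) / P) * P - c =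
          ((t₀ - c) / P - round ((t₀ - c) / P)) * P := by field_simp; ring
      rw [this, abs_mul, abs_of_pos hP]
      nlinarith [abs_sub_round ((t₀ - c) / P)]
    generalize round ((t₀ - c) / P) = k at hk
    have hsmooth : ContDiff ℝ n fun t : ℝ => h (t - k * P) :=
      hh.comp (contDiff_id.sub contDiff_const)
    refine hsmooth.contDiffAt.congr_of_eventuallyEq ?_
    have hcont : Continuous fun t : ℝ => |t - k * P - c| := by fun_prop
    filter_upwards [hcont.continuousAt.eventually_lt continuousAt_const hk] with t ht
    exact key t k ht
  · have : (t + P - c) / P = (t - c) / P + 1 := by field_simp; ring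
    simp only [this, round_add_one]
    push_cast
    congr 1
    ring
  · simpa using key t 0 (by simpa using by linarith)

/-- Gluing construction in the second corollary: any smooth function on `ℝ` agrees on a
compact interval `[a, b]` with a smooth function that is periodic of any period
`P > b - a`. -/
theorem smooth_periodic_extension {E : Type*} [NormedAddCommGroup E] [NormedSpace ℝ E]
    (g : ℝ → E) (hg : ContDiff ℝ (⊤ : ℕ∞) g) (a b P : ℝ) (hab : a < b) (hP : b - a < P) :
    ∃ G : ℝ → E, ContDiff ℝ (⊤ : ℕ∞) G ∧ (∀ t : ℝ, G (t + P) = G t) ∧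
      ∀ t ∈ Set.Icc a b, G t = g t := by
  let f : ContDiffBump ((a + b) / 2) :=
    ⟨(b - a) / 2, ((b - a) / 2 + P / 2) / 2, by linarith, by linarith⟩
  obtain ⟨G, hG, hGP, hGf⟩ := exists_contDiff_periodic_of_eq_zero (h := fun t => f t • g t)
    (f.contDiff.smul hg) (c := (a + b) / 2) (r := ((b - a) / 2 + P / 2) / 2) (P := P)
    (by linarith) (by linarith) fun t ht => by
      have : f t = 0 := f.zero_of_le_dist (by rwa [Real.dist_eq])
      simp [this]
  refine ⟨G, hG, hGP, fun t ht => ?_⟩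
  have habs : |t - (a + b) / 2| ≤ (b - a) / 2 :=
    abs_le.2 ⟨by linarith [ht.1], by linarith [ht.2]⟩
  have hone : f t = 1 :=
    f.one_of_mem_closedBall (by rwa [Metric.mem_closedBall, Real.dist_eq])
  rw [hGf t (by linarith), hone, one_smul]
end
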